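/- Suppose α, β > 0, α(‖P‖ + β‖H‖²) < 1, and ρ ∈ (0, 2), and let (z^j, w^j, ξ^j, η^j) be the xPIPG iterates from arbitrary initial points ξ¹ ∈ ℝ^n, η¹ ∈ ℝ^m. If the limit w̄ := lim_{j→∞} (w^{j+1} − w^j) (which exists) is nonzero, then inf_{z∈D} ⟨Hz − g, w̄⟩ > sup_{y∈K} ⟨y, w̄⟩; that is, w̄ is a proof of primal infeasibility of the conic optimization problem of minimizing (1/2)zᵀPz + qᵀz subject to Hz − g ∈ K and z ∈ D. -/

import Mathlib

open scoped RealInnerProductSpace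
open Filter Topology Matrix

/-- Spectral norm (largest singular value) of a real matrix. -/
noncomputable def specNorm {ι κ : Type*} [Fintype ι] [Fintype κ] [DecidableEq κ]
    (A : Matrix ι κ ℝ) : ℝ :=
  ‖LinearMap.toContinuousLinearMap (Matrix.toEuclideanLin A)‖

/-- The linear map on Euclidean space induced by a matrix (matrix-vector product). -/
noncomputable def mvec {ι κ : Type*} [Fintype ι] [Fintype κ] [DecidableEq κ]
    (A : Matrix ι κ ℝ) (x : EuclideanSpace ℝ κ) : EuclideanSpace ℝ ι :=
  Matrix.toEuclideanLin A x

open Classical in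
/-- Projection onto a (nonempty closed convex) set: the minimizer of the distance to `x`. -/
noncomputable def proj {ι : Type*} [Fintype ι] (C : Set (EuclideanSpace ℝ ι))
    (x : EuclideanSpace ℝ ι) : EuclideanSpace ℝ ι :=
  if h : ∃ y ∈ C, ∀ c ∈ C, ‖x - y‖ ≤ ‖x - c‖ then h.choose else x

/-- Polar cone `K° = {w | ⟨w, y⟩ ≤ 0 for all y ∈ K}`. -/
def polarCone {ι : Type*} [Fintype ι] (K : Set (EuclideanSpace ℝ ι)) :
    Set (EuclideanSpace ℝ ι) := {w | ∀ y ∈ K, ⟪w, y⟫ ≤ 0}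

/-- Recession cone `rec D = {y | y + z ∈ D for all z ∈ D}`. -/
def recCone {ι : Type*} [Fintype ι] (D : Set (EuclideanSpace ℝ ι)) :
    Set (EuclideanSpace ℝ ι) := {y | ∀ z ∈ D, y + z ∈ D}

/-- Normal cone of `C` at `x`: `N_C(x) = {y | ⟨y, x' − x⟩ ≤ 0 for all x' ∈ C}`. -/
def normalCone {ι : Type*} [Fintype ι] (C : Set (EuclideanSpace ℝ ι))
    (x : EuclideanSpace ℝ ι) : Set (EuclideanSpace ℝ ι) :=
  {y | ∀ x' ∈ C, ⟪y, x' - x⟫ ≤ 0}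

/-- A closed convex cone. -/
def IsClosedConvexCone {ι : Type*} [Fintype ι] (K : Set (EuclideanSpace ℝ ι)) : Prop :=
  IsClosed K ∧ Convex ℝ K ∧ ∀ w ∈ K, ∀ c : ℝ, 0 ≤ c → c • w ∈ K

/-- Support function of `D`, valued in `EReal`: `σ_D(x) = sup_{y ∈ D} ⟨y, x⟩`. -/
noncomputable def supportF {ι : Type*} [Fintype ι] (D : Set (EuclideanSpace ℝ ι))
    (x : EuclideanSpace ℝ ι) : EReal :=
  ⨆ y : D, ((⟪(y : EuclideanSpace ℝ ι), x⟫ : ℝ) : EReal)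

section RelaxedIteration
variable {F : Type*} [NormedAddCommGroup F] [InnerProductSpace ℝ F]

/-- One relaxed step of a firmly nonexpansive iteration contracts distances. -/
lemma relaxed_step_norm_sq_le {ρ : ℝ} (hρ : 0 < ρ) {s e : ℕ → F}
    (hs : ∀ n, s (n + 1) = s n + ρ • e n)
    (hmono : ∀ i j, ⟪e i - e j, (s i + e i) - (s j + e j)⟫ ≤ 0) (i j : ℕ) :
    ‖s (i + 1) - s (j + 1)‖ ^ 2 ≤
      ‖s i - s j‖ ^ 2 - ρ * (2 - ρ) * ‖e i - e j‖ ^ 2 := by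
  have h1 : s (i + 1) - s (j + 1) = (s i - s j) + ρ • (e i - e j) := by
    rw [hs, hs]; module
  have h2 : (s i + e i) - (s j + e j) = (s i - s j) + (e i - e j) := by module
  have h3 := hmono i j
  rw [h2, inner_add_right, real_inner_self_eq_norm_sq] at h3
  rw [h1, norm_add_sq_real, real_inner_smul_right, norm_smul, mul_pow, Real.norm_eq_abs, sq_abs,
    real_inner_comm]
  nlinarith [mul_le_mul_of_nonneg_left h3 hρ.le]

/-- The increments of a relaxed firmly nonexpansive iteration converge. -/
lemma exists_tendsto_increment [FiniteDimensional ℝ F] {ρ : ℝ} (hρ : 0 < ρ) (hρ2 : ρ < 2)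
    {s e : ℕ → F} (hs : ∀ n, s (n + 1) = s n + ρ • e n)
    (hmono : ∀ i j, ⟪e i - e j, (s i + e i) - (s j + e j)⟫ ≤ 0) :
    ∃ v, Tendsto e atTop (𝓝 v) := by
  have hstep := relaxed_step_norm_sq_le hρ hs hmono
  have hc : 0 < ρ * (2 - ρ) := mul_pos hρ (by linarith)
  have hne : ∀ i j, ‖s (i + 1) - s (j + 1)‖ ≤ ‖s i - s j‖ := fun i j => by
    refine le_of_sq_le_sq ?_ (norm_nonneg _)
    nlinarith [hstep i j, sq_nonneg ‖e i - e j‖]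
  have hd : ∀ n, s (n + 1) - s n = ρ • e n := fun n => by rw [hs]; module
  have hdec : ∀ n, ρ * (2 - ρ) * ‖e (n + 1) - e n‖ ^ 2 ≤
      ρ ^ 2 * (‖e n‖ ^ 2 - ‖e (n + 1)‖ ^ 2) := fun n => by
    have := hstep (n + 1) n
    rw [hd, hd, norm_smul, norm_smul, mul_pow, mul_pow, Real.norm_eq_abs, sq_abs] at this
    linarith
  have hanti : Antitone fun n => ‖e n‖ := antitone_nat_of_succ_le fun n => by
    refine le_of_sq_le_sq ?_ (norm_nonneg _)
    have h := (mul_nonneg hc.le (sq_nonneg ‖e (n + 1) - e n‖)).trans (hdec n)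
    have := nonneg_of_mul_nonneg_right h (by positivity)
    linarith
  obtain ⟨L, hL⟩ : ∃ L, Tendsto (fun n => ‖e n‖) atTop (𝓝 L) :=
    ⟨_, tendsto_atTop_ciInf hanti ⟨0, by rintro _ ⟨n, rfl⟩; exact norm_nonneg _⟩⟩
  have hL0 : 0 ≤ L := ge_of_tendsto' hL fun n => norm_nonneg _
  have hLe : ∀ n, L ≤ ‖e n‖ := fun n => hanti.le_of_tendsto hL n
  have hee : Tendsto (fun n => e (n + 1) - e n) atTop (𝓝 0) := by
    have h1 : Tendsto (fun n => ρ ^ 2 * (‖e n‖ ^ 2 - ‖e (n + 1)‖ ^ 2) / (ρ * (2 - ρ)))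
        atTop (𝓝 0) := by
      have := (((hL.pow 2).sub ((hL.comp (tendsto_add_atTop_nat 1)).pow 2)).const_mul
        (ρ ^ 2)).div_const (ρ * (2 - ρ))
      simpa using this
    have h2 : Tendsto (fun n => ‖e (n + 1) - e n‖ ^ 2) atTop (𝓝 0) :=
      squeeze_zero (fun n => sq_nonneg _)
        (fun n => by rw [le_div_iff₀ hc]; linarith [hdec n]) h1
    have h3 := h2.sqrt
    simp only [Real.sqrt_sq (norm_nonneg _), Real.sqrt_zero] at h3
    exact tendsto_zero_iff_norm_tendsto_zero.2 h3
  have hk : ∀ k : ℕ, Tendsto (fun n => s (n + k) - s n - ((k : ℝ) * ρ) • e n) atTop (𝓝 0) := by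
    have hek : ∀ k : ℕ, Tendsto (fun n => e (n + k) - e n) atTop (𝓝 0) := fun k => by
      induction k with
      | zero => simp
      | succ k ih =>
        have := (hee.comp (tendsto_add_atTop_nat k)).add ih
        simp only [add_zero] at this
        refine this.congr fun n => ?_
        simp only [Function.comp_apply, add_assoc]
        module
    intro k
    induction k with
    | zero => simp
    | succ k ih =>
      have := ih.add ((hek k).const_smul ρ)
      simp only [smul_zero, add_zero] at this
      refine this.congr fun n => ?_
      rw [← add_assoc, hs (n + k)]
      push_cast
      module
  have hlow : ∀ k n : ℕ, k * ρ * L ≤ ‖s (n + k) - s n‖ := fun k n => by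
    have ha : Antitone fun n => ‖s (n + k) - s n‖ := antitone_nat_of_succ_le fun n => by
      have := hne (n + k) n
      rwa [show n + k + 1 = n + 1 + k by ring] at this
    refine ha.le_of_tendsto ?_ n
    have h1 : Tendsto (fun n => ‖((k : ℝ) * ρ) • e n‖) atTop (𝓝 (k * ρ * L)) := by
      simp only [norm_smul, Real.norm_of_nonneg (mul_nonneg k.cast_nonneg hρ.le)]
      exact hL.const_mul _
    have h2 : Tendsto (fun n => ‖s (n + k) - s n‖ - ‖((k : ℝ) * ρ) • e n‖) atTop (𝓝 0) :=
      squeeze_zero_norm (fun n => abs_norm_sub_norm_le _ _)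
        (tendsto_zero_iff_norm_tendsto_zero.1 (hk k))
    simpa using h2.add h1
  have hup : ∀ i k : ℕ, ‖s (i + k) - s i‖ ≤ k * (ρ * ‖e i‖) := fun i k => by
    induction k with
    | zero => simp
    | succ k ih =>
      have h1 : s (i + (k + 1)) - s i = (s (i + k) - s i) + ρ • e (i + k) := by
        rw [← add_assoc, hs]; module
      have h2 := norm_add_le (s (i + k) - s i) (ρ • e (i + k))
      rw [norm_smul, Real.norm_of_nonneg hρ.le] at h2
      have h3 := mul_le_mul_of_nonneg_left (hanti (Nat.le_add_right i k)) hρ.le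
      rw [h1]; push_cast
      simp only at h3
      linarith
  have hshift : ∀ i k : ℕ, ‖s (i + k) - s (0 + k)‖ ≤ ‖s i - s 0‖ := fun i k => by
    induction k with
    | zero => simp
    | succ k ih => exact (hne _ _).trans ih
  let S : ℕ → ℕ → F := fun i N => ∑ k ∈ Finset.range N, (s (i + k) - s i)
  have hSup : ∀ i N : ℕ, 2 * ‖S i N‖ ≤ N ^ 2 * (ρ * ‖e i‖) := fun i N => by
    induction N with
    | zero => simp [S]
    | succ N ih =>
      have h1 : S i (N + 1) = S i N + (s (i + N) - s i) := Finset.sum_range_succ _ _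
      have h2 := norm_add_le (S i N) (s (i + N) - s i)
      have h3 := hup i N
      have h4 : 0 ≤ ρ * ‖e i‖ := by positivity
      rw [h1]; push_cast
      nlinarith
  have hSin : ∀ i N : ℕ, ‖s (i + N) - s i‖ ^ 2 ≤
      2 * ρ * ⟪e i, S i N⟫ + N * (ρ ^ 2 * ‖e i‖ ^ 2) := fun i N => by
    induction N with
    | zero => simp [S]
    | succ N ih =>
      have h1 : S i (N + 1) = S i N + (s (i + N) - s i) := Finset.sum_range_succ _ _
      have h2 : s (i + (N + 1)) - s i = (s (i + N) - s i) + ρ • e (i + N) := by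
        rw [← add_assoc, hs]; module
      have h3 := hmono (i + N) i
      rw [show s (i + N) + e (i + N) - (s i + e i) = (s (i + N) - s i) + (e (i + N) - e i) by
        module, inner_add_right, real_inner_self_eq_norm_sq, inner_sub_left] at h3
      have h4 : ‖e (i + N)‖ ^ 2 ≤ ‖e i‖ ^ 2 :=
        pow_le_pow_left₀ (norm_nonneg _) (hanti (Nat.le_add_right i N)) 2
      rw [h1, h2, norm_add_sq_real, real_inner_smul_right, norm_smul, mul_pow, Real.norm_eq_abs,
        sq_abs, real_inner_comm, inner_add_right]
      push_cast
      have h5 : ⟪e (i + N), s (i + N) - s i⟫ ≤ ⟪e i, s (i + N) - s i⟫ := by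
        nlinarith [sq_nonneg ‖e (i + N) - e i‖]
      nlinarith [mul_le_mul_of_nonneg_left h5 hρ.le, mul_le_mul_of_nonneg_left h4 (sq_nonneg ρ)]
  have hSsub : ∀ i N : ℕ, ‖S i N - S 0 N‖ ≤ N * (2 * ‖s i - s 0‖) := fun i N => by
    simp only [S, ← Finset.sum_sub_distrib]
    refine (norm_sum_le_of_le _ (f := fun k => (s (i + k) - s i) - (s (0 + k) - s 0))
      (n := fun _ => 2 * ‖s i - s 0‖) fun k _ => ?_).trans (by simp)
    rw [show (s (i + k) - s i) - (s (0 + k) - s 0) = (s (i + k) - s (0 + k)) - (s i - s 0) by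
      module]
    linarith [norm_sub_le (s (i + k) - s (0 + k)) (s i - s 0), hshift i k]
  let G : ℕ → ℕ → F := fun i N => (2 / (ρ * ((N : ℝ) + 1) ^ 2)) • S i (N + 1)
  have hcoef : ∀ N : ℕ, 0 < 2 / (ρ * ((N : ℝ) + 1) ^ 2) := fun N => by positivity
  have hGup : ∀ i N, ‖G i N‖ ≤ ‖e i‖ := fun i N => by
    have := hSup i (N + 1)
    simp only [G]
    rw [norm_smul, Real.norm_of_nonneg (hcoef N).le, div_mul_eq_mul_div,
      div_le_iff₀ (by positivity)]
    push_cast at this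
    linarith
  have hGin : ∀ i N : ℕ, L ^ 2 - ‖e i‖ ^ 2 * (1 / ((N : ℝ) + 1)) ≤ ⟪e i, G i N⟫ := fun i N => by
    have h1 := hSin i (N + 1)
    have h2 := pow_le_pow_left₀ (by positivity) (hlow (N + 1) i) 2
    have h3 := h2.trans h1
    simp only [G]
    rw [real_inner_smul_right, div_mul_eq_mul_div, le_div_iff₀ (by positivity)]
    push_cast at h3
    have h4 : (L ^ 2 - ‖e i‖ ^ 2 * (1 / ((N : ℝ) + 1))) * (ρ * ((N : ℝ) + 1) ^ 2) =
        ρ * (((N : ℝ) + 1) ^ 2 * L ^ 2 - ((N : ℝ) + 1) * ‖e i‖ ^ 2) := by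
      field_simp
    rw [h4]
    refine le_of_mul_le_mul_left ?_ hρ
    linarith
  have hGsub : ∀ i, Tendsto (fun N => G i N - G 0 N) atTop (𝓝 0) := fun i => by
    refine squeeze_zero_norm (a := fun N : ℕ => 4 * ‖s i - s 0‖ / ρ * (1 / ((N : ℝ) + 1)))
      (fun N => ?_) ?_
    · simp only [G]
      rw [← smul_sub, norm_smul, Real.norm_of_nonneg (hcoef N).le]
      refine (mul_le_mul_of_nonneg_left (hSsub i (N + 1)) (hcoef N).le).trans (le_of_eq ?_)
      push_cast
      field_simp
      ring
    · simpa using tendsto_one_div_add_atTop_nhds_zero_nat.const_mul (4 * ‖s i - s 0‖ / ρ)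
  obtain ⟨v, -, φ, hφ, hv⟩ := tendsto_subseq_of_bounded
    (Metric.isBounded_closedBall (x := (0 : F)) (r := ‖e 0‖))
    (fun N => mem_closedBall_zero_iff.2 (hGup 0 N))
  have hGv : ∀ i, Tendsto (fun N => G i (φ N)) atTop (𝓝 v) := fun i => by
    simpa using ((hGsub i).comp hφ.tendsto_atTop).add hv
  have hvup : ∀ i, ‖v‖ ≤ ‖e i‖ := fun i => le_of_tendsto' (hGv i).norm fun N => hGup i _
  have hvin : ∀ i, L ^ 2 ≤ ⟪e i, v⟫ := fun i => by
    refine le_of_tendsto_of_tendsto' ?_ (tendsto_const_nhds.inner (hGv i))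
      fun N => hGin i (φ N)
    simpa using ((tendsto_one_div_add_atTop_nhds_zero_nat.comp hφ.tendsto_atTop).const_mul
      (‖e i‖ ^ 2)).const_sub (L ^ 2)
  refine ⟨v, tendsto_iff_norm_sub_tendsto_zero.2 ?_⟩
  have h2 : Tendsto (fun n => ‖e n - v‖ ^ 2) atTop (𝓝 0) := by
    refine squeeze_zero (g := fun n => 2 * (‖e n‖ ^ 2 - L ^ 2)) (fun n => sq_nonneg _)
      (fun n => ?_) ?_
    · rw [norm_sub_sq_real]
      linarith [hvin n, pow_le_pow_left₀ (norm_nonneg v) (hvup n) 2]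
    · have h3 : Tendsto (fun n => 2 * (‖e n‖ ^ 2 - L ^ 2)) atTop (𝓝 (2 * (L ^ 2 - L ^ 2))) :=
        ((hL.pow 2).sub_const (L ^ 2)).const_mul 2
      rwa [sub_self, mul_zero] at h3
  have h3 := h2.sqrt
  simpa only [Real.sqrt_sq (norm_nonneg _), Real.sqrt_zero] using h3

end RelaxedIteration

/-- Version of `exists_tendsto_increment` for the metric of a positive definite form. -/
lemma exists_tendsto_increment_of_bilin {E : Type*} [AddCommGroup E] [Module ℝ E]
    [FiniteDimensional ℝ E] (B : E →ₗ[ℝ] E →ₗ[ℝ] ℝ) (hsymm : ∀ x y, B x y = B y x)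
    (hpos : ∀ x, x ≠ 0 → 0 < B x x) {ρ : ℝ} (hρ : 0 < ρ) (hρ2 : ρ < 2)
    {s e : ℕ → E} (hs : ∀ n, s (n + 1) = s n + ρ • e n)
    (hmono : ∀ i j, B (e i - e j) ((s i + e i) - (s j + e j)) ≤ 0) :
    ∃ v, ∀ (G : Type) [NormedAddCommGroup G] [NormedSpace ℝ G] (T : E →ₗ[ℝ] G),
      Tendsto (fun n => T (e n)) atTop (𝓝 (T v)) := by
  let c : InnerProductSpace.Core ℝ E :=
    { inner := fun x y => B x y
      conj_inner_symm := fun x y => hsymm y x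
      re_inner_nonneg := fun x => by
        rcases eq_or_ne x 0 with rfl | h
        · simp
        · exact (hpos x h).le
      add_left := fun x y z => by simp
      smul_left := fun x y r => by simp
      definite := fun x h => by
        by_contra hx
        exact (hpos x hx).ne' h }
  let _ : NormedAddCommGroup E := @InnerProductSpace.Core.toNormedAddCommGroup ℝ E _ _ _ c
  let _ : InnerProductSpace ℝ E := InnerProductSpace.ofCore c.toCore
  obtain ⟨v, hv⟩ := exists_tendsto_increment hρ hρ2 hs hmono
  exact ⟨v, fun G _ _ T => (T.continuous_of_finiteDimensional.tendsto v).comp hv⟩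

section Iteration
variable {X Y : Type*} [NormedAddCommGroup X] [InnerProductSpace ℝ X]
  [NormedAddCommGroup Y] [InnerProductSpace ℝ Y]

/-- The form `‖x‖²/α − ⟨Px, x⟩ − 2⟨Hx, y⟩ + ‖y‖²/β` in which the unrelaxed iteration is a
proximal point step. -/
noncomputable def stepForm (P : X →ₗ[ℝ] X) (H : X →ₗ[ℝ] Y) (α β : ℝ) :
    X × Y →ₗ[ℝ] X × Y →ₗ[ℝ] ℝ :=
  LinearMap.mk₂ ℝ
    (fun u v => α⁻¹ * ⟪u.1, v.1⟫ - ⟪P u.1, v.1⟫ - ⟪H u.1, v.2⟫ - ⟪H v.1, u.2⟫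
      + β⁻¹ * ⟪u.2, v.2⟫)
    (fun u u' v => by simp [inner_add_left, inner_add_right]; ring)
    (fun c u v => by simp [inner_smul_left, inner_smul_right]; ring)
    (fun u v v' => by simp [inner_add_left, inner_add_right]; ring)
    (fun c u v => by simp [inner_smul_left, inner_smul_right]; ring)

lemma stepForm_apply (P : X →ₗ[ℝ] X) (H : X →ₗ[ℝ] Y) (α β : ℝ) (u v : X × Y) :
    stepForm P H α β u v = α⁻¹ * ⟪u.1, v.1⟫ - ⟪P u.1, v.1⟫ - ⟪H u.1, v.2⟫ - ⟪H v.1, u.2⟫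
      + β⁻¹ * ⟪u.2, v.2⟫ := rfl

lemma stepForm_comm {P : X →ₗ[ℝ] X} (hP : ∀ x y, ⟪P x, y⟫ = ⟪x, P y⟫) (H : X →ₗ[ℝ] Y) (α β : ℝ)
    (u v : X × Y) : stepForm P H α β u v = stepForm P H α β v u := by
  rw [stepForm_apply, stepForm_apply, hP, real_inner_comm (P v.1), real_inner_comm v.1 u.1,
    real_inner_comm v.2 u.2]
  ring

lemma stepForm_pos {P : X →ₗ[ℝ] X} {H : X →ₗ[ℝ] Y} {α β p h : ℝ} (hα : 0 < α) (hβ : 0 < β)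
    (hstep : α * (p + β * h ^ 2) < 1) (hp : ∀ x, ‖P x‖ ≤ p * ‖x‖) (hh : ∀ x, ‖H x‖ ≤ h * ‖x‖)
    (u : X × Y) (hu : u ≠ 0) : 0 < stepForm P H α β u u := by
  obtain ⟨x, y⟩ := u
  simp only [stepForm_apply, real_inner_self_eq_norm_sq]
  have h1 : ⟪P x, x⟫ ≤ p * ‖x‖ ^ 2 := by
    nlinarith [real_inner_le_norm (P x) x, hp x, norm_nonneg x]
  have h2 : ⟪H x, y⟫ ≤ h * ‖x‖ * ‖y‖ :=
    (real_inner_le_norm _ _).trans (mul_le_mul_of_nonneg_right (hh x) (norm_nonneg y))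
  have h3 : 0 < α⁻¹ - p - β * h ^ 2 := by
    have : p + β * h ^ 2 < α⁻¹ := by
      simpa using (lt_inv_mul_iff₀ hα).2 hstep
    linarith
  have h4 : α⁻¹ * ‖x‖ ^ 2 - p * ‖x‖ ^ 2 - 2 * (h * ‖x‖ * ‖y‖) + β⁻¹ * ‖y‖ ^ 2 =
      (α⁻¹ - p - β * h ^ 2) * ‖x‖ ^ 2 + β⁻¹ * (‖y‖ - β * h * ‖x‖) ^ 2 := by
    field_simp
    ring
  have h5 : 0 < (α⁻¹ - p - β * h ^ 2) * ‖x‖ ^ 2 + β⁻¹ * (‖y‖ - β * h * ‖x‖) ^ 2 := by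
    rcases eq_or_ne x 0 with rfl | hx
    · have hy : 0 < ‖y‖ := norm_pos_iff.2 fun hy => hu (by rw [hy]; rfl)
      simp only [norm_zero, mul_zero, sub_zero]
      positivity
    · have := norm_pos_iff.2 hx
      positivity
  linarith

lemma stepForm_monotone {P : X →ₗ[ℝ] X} {H : X →ₗ[ℝ] Y} {H' : Y →ₗ[ℝ] X}
    (hadj : ∀ x y, ⟪H x, y⟫ = ⟪x, H' y⟫) (hP0 : ∀ x, 0 ≤ ⟪P x, x⟫) {α β : ℝ} {q : X} {g : Y}
    {D : Set X} {C : Set Y} {x z : ℕ → X} {y w : ℕ → Y}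
    (hzD : ∀ n, z n ∈ D) (hwC : ∀ n, w n ∈ C)
    (hz : ∀ n, ∀ c ∈ D, ⟪α⁻¹ • (x n - z n) - (P (x n) + q + H' (y n)), c - z n⟫ ≤ 0)
    (hw : ∀ n, ∀ c ∈ C, ⟪β⁻¹ • (y n - w n) + (H ((2 : ℝ) • z n - x n) - g), c - w n⟫ ≤ 0)
    (i j : ℕ) :
    stepForm P H α β ((z i - x i, w i - y i) - (z j - x j, w j - y j))
      (((x i, y i) + (z i - x i, w i - y i)) - ((x j, y j) + (z j - x j, w j - y j))) ≤ 0 := by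
  have hadj' : ∀ x y, ⟪H' y, x⟫ = ⟪H x, y⟫ := fun x y => by rw [real_inner_comm, hadj]
  have h1 := hz i _ (hzD j)
  have h2 := hz j _ (hzD i)
  have h3 := hw i _ (hwC j)
  have h4 := hw j _ (hwC i)
  have h5 := hP0 (z i - z j)
  simp only [stepForm_apply, Prod.mk_sub_mk, Prod.mk_add_mk, add_sub_cancel, map_sub, map_smul,
    inner_sub_left,
    inner_sub_right, inner_add_left, real_inner_smul_left, hadj'] at h1 h2 h3 h4 h5 ⊢
  linarith

/-- If the residuals `z − x` and `w − y` of the relaxed iteration converge to `a` and `b`, then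
`b` separates `H D − g` from the cone whose polar is `C`. -/
lemma le_inner_of_tendsto_residual {P : X →L[ℝ] X} {H : X →L[ℝ] Y} {H' : Y →L[ℝ] X}
    (hadj : ∀ x y, ⟪H x, y⟫ = ⟪x, H' y⟫) (hPs : ∀ x y, ⟪P x, y⟫ = ⟪x, P y⟫)
    (hP0 : ∀ x, 0 ≤ ⟪P x, x⟫) (hPz : ∀ x, ⟪P x, x⟫ ≤ 0 → P x = 0)
    {α β ρ : ℝ} (hρ : 0 < ρ) {q : X} {g : Y}
    {D : Set X} {C : Set Y} (hDne : D.Nonempty) (hDcl : IsClosed D) (hDcv : Convex ℝ D)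
    (hCcl : IsClosed C) (hC0 : 0 ∈ C) (hCadd : ∀ u ∈ C, ∀ v ∈ C, u + v ∈ C)
    (hCsmul : ∀ u ∈ C, ∀ r : ℝ, 0 ≤ r → r • u ∈ C)
    {x z : ℕ → X} {y w : ℕ → Y} (hzD : ∀ n, z n ∈ D) (hwC : ∀ n, w n ∈ C)
    (hz : ∀ n, ∀ c ∈ D, ⟪α⁻¹ • (x n - z n) - (P (x n) + q + H' (y n)), c - z n⟫ ≤ 0)
    (hw : ∀ n, ∀ c ∈ C, ⟪β⁻¹ • (y n - w n) + (H ((2 : ℝ) • z n - x n) - g), c - w n⟫ ≤ 0)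
    (hx : ∀ n, x (n + 1) = x n + ρ • (z n - x n)) (hy : ∀ n, y (n + 1) = y n + ρ • (w n - y n))
    {a : X} {b : Y} (ha : Tendsto (fun n => z n - x n) atTop (𝓝 a))
    (hb : Tendsto (fun n => w n - y n) atTop (𝓝 b)) :
    ρ • b ∈ C ∧ ∀ c ∈ D, β⁻¹ * ⟪b, ρ • b⟫ ≤ ⟪H c - g, ρ • b⟫ := by
  have hinv : Tendsto (fun n : ℕ => (n : ℝ)⁻¹) atTop (𝓝 0) := tendsto_inv_atTop_nhds_zero_nat
  have hx' : Tendsto (fun n : ℕ => (n : ℝ)⁻¹ • x n) atTop (𝓝 (ρ • a)) := by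
    have h1 := (ha.const_smul ρ).cesaro_smul
    have h2 := h1.add (hinv.smul_const (x 0))
    simp only [zero_smul, add_zero] at h2
    refine h2.congr fun n => ?_
    have : ∀ k, ρ • (z k - x k) = x (k + 1) - x k := fun k => by rw [hx]; module
    simp only [this, Finset.sum_range_sub]
    module
  have hy' : Tendsto (fun n : ℕ => (n : ℝ)⁻¹ • y n) atTop (𝓝 (ρ • b)) := by
    have h1 := (hb.const_smul ρ).cesaro_smul
    have h2 := h1.add (hinv.smul_const (y 0))
    simp only [zero_smul, add_zero] at h2
    refine h2.congr fun n => ?_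
    have : ∀ k, ρ • (w k - y k) = y (k + 1) - y k := fun k => by rw [hy]; module
    simp only [this, Finset.sum_range_sub]
    module
  have hz' : Tendsto (fun n : ℕ => (n : ℝ)⁻¹ • z n) atTop (𝓝 (ρ • a)) := by
    have := hx'.add (hinv.smul ha)
    simp only [zero_smul, add_zero] at this
    exact this.congr fun n => by module
  have hw' : Tendsto (fun n : ℕ => (n : ℝ)⁻¹ • w n) atTop (𝓝 (ρ • b)) := by
    have := hy'.add (hinv.smul hb)
    simp only [zero_smul, add_zero] at this
    exact this.congr fun n => by module
  have hpos : ∀ n : ℕ, 0 ≤ (n : ℝ)⁻¹ := fun n => by positivity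
  set Z := ρ • a with hZ
  set W := ρ • b with hW
  let p : ℕ → X := fun n => α⁻¹ • (x n - z n) - (P (x n) + q + H' (y n))
  let m : ℕ → Y := fun n => β⁻¹ • (y n - w n) + (H ((2 : ℝ) • z n - x n) - g)
  have hp' : Tendsto (fun n : ℕ => (n : ℝ)⁻¹ • p n) atTop (𝓝 (-(P Z + H' W))) := by
    have h1 := (((hx'.sub hz').const_smul α⁻¹).sub
      ((((P.continuous.tendsto _).comp hx').add (hinv.smul_const q)).add
        ((H'.continuous.tendsto _).comp hy')))
    simp only [sub_self, smul_zero, zero_smul, add_zero, zero_sub] at h1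
    refine h1.congr fun n => ?_
    simp only [Function.comp_apply, map_smul, p]
    module
  have hm' : Tendsto (fun n : ℕ => (n : ℝ)⁻¹ • m n) atTop (𝓝 (H Z)) := by
    have h1 := (((hy'.sub hw').const_smul β⁻¹).add
      (((H.continuous.tendsto _).comp ((hz'.const_smul (2 : ℝ)).sub hx')).sub
        (hinv.smul_const g)))
    simp only [sub_self, smul_zero, zero_smul, zero_add, sub_zero] at h1
    rw [show (2 : ℝ) • Z - Z = Z by module] at h1
    refine h1.congr fun n => ?_
    simp only [Function.comp_apply, map_smul, map_sub, m]
    module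
  have hWC : W ∈ C := hCcl.mem_of_tendsto hw' (Eventually.of_forall fun n =>
    hCsmul _ (hwC n) _ (hpos n))
  have hmc : ∀ n, ∀ c ∈ C, ⟪m n, c⟫ ≤ 0 := fun n c hc => by
    simpa only [add_sub_cancel_right] using hw n _ (hCadd _ hc _ (hwC n))
  have hmw : ∀ n, 0 ≤ ⟪m n, w n⟫ := fun n => by
    have h : ⟪m n, 0 - w n⟫ ≤ 0 := hw n _ hC0
    rwa [zero_sub, inner_neg_right, neg_nonpos] at h
  have hHZ : ∀ c ∈ C, ⟪H Z, c⟫ ≤ 0 := fun c hc =>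
    le_of_tendsto' (hm'.inner tendsto_const_nhds) fun n => by
      rw [real_inner_smul_left]
      exact mul_nonpos_of_nonneg_of_nonpos (hpos n) (hmc n c hc)
  have hHZW : ⟪H Z, W⟫ = 0 := le_antisymm (hHZ _ hWC) <|
    ge_of_tendsto' (hm'.inner hw') fun n => by
      rw [real_inner_smul_left, real_inner_smul_right]
      exact mul_nonneg (hpos n) (mul_nonneg (hpos n) (hmw n))
  have hPZ : P Z = 0 := by
    obtain ⟨c, hc⟩ := hDne
    refine hPz Z ?_
    have h1 : Tendsto (fun n : ℕ => ⟪(n : ℝ)⁻¹ • p n, (n : ℝ)⁻¹ • c - (n : ℝ)⁻¹ • z n⟫) atTop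
        (𝓝 ⟪-(P Z + H' W), (0 : ℝ) • c - Z⟫) := hp'.inner ((hinv.smul_const c).sub hz')
    have h2 := le_of_tendsto' h1 (b := 0) fun n => by
      rw [← smul_sub, real_inner_smul_left, real_inner_smul_right]
      exact mul_nonpos_of_nonneg_of_nonpos (hpos n)
        (mul_nonpos_of_nonneg_of_nonpos (hpos n) (hz n c hc))
    rw [zero_smul, zero_sub, inner_neg_neg, inner_add_left, real_inner_comm Z (H' W), ← hadj,
      hHZW, add_zero] at h2
    exact h2
  have hrec : ∀ c ∈ D, c + Z ∈ D := fun c hc => by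
    have h1 : Tendsto (fun n : ℕ => (1 - (n : ℝ)⁻¹) • c + (n : ℝ)⁻¹ • z n) atTop
        (𝓝 ((1 - (0 : ℝ)) • c + Z)) := ((hinv.const_sub 1).smul_const c).add hz'
    rw [sub_zero, one_smul] at h1
    refine hDcl.mem_of_tendsto h1 ((eventually_ge_atTop 1).mono fun n hn => ?_)
    exact hDcv hc (hzD n) (sub_nonneg.2 (inv_le_one_of_one_le₀ (by exact_mod_cast hn))) (hpos n)
      (by ring)
  have hHaW : ⟪H a, W⟫ = 0 := by
    rw [hZ, map_smul, real_inner_smul_left] at hHZW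
    exact (mul_eq_zero.1 hHZW).resolve_left hρ.ne'
  have hbHZ : ⟪b, H Z⟫ = 0 := by
    rw [hW, real_inner_smul_right, real_inner_comm] at hHZW
    exact (mul_eq_zero.1 hHZW).resolve_left hρ.ne'
  have hq : -α⁻¹ * ⟪a, Z⟫ ≤ ⟪q, Z⟫ := by
    have h1 : Tendsto (fun n => -α⁻¹ * ⟪z n - x n, Z⟫ + ⟪w n - y n, H Z⟫) atTop
        (𝓝 (-α⁻¹ * ⟪a, Z⟫ + ⟪b, H Z⟫)) :=
      ((ha.inner tendsto_const_nhds).const_mul _).add (hb.inner tendsto_const_nhds)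
    rw [hbHZ, add_zero] at h1
    refine le_of_tendsto' h1 fun n => ?_
    have h2 : ⟪p n, Z⟫ ≤ 0 := by
      simpa using hz n _ (hrec _ (hzD n))
    have h3 := hHZ _ (hwC n)
    simp only [p, inner_sub_left, inner_add_left, real_inner_smul_left, hPs, hPZ,
      inner_zero_right, real_inner_comm Z (H' _), ← hadj] at h2
    rw [inner_sub_left, inner_sub_left, real_inner_comm (H Z), real_inner_comm (H Z)]
    linarith
  refine ⟨hWC, fun c hc => ?_⟩
  have hlim : Tendsto (fun n : ℕ => -α⁻¹ * ⟪z n - x n, (n : ℝ)⁻¹ • z n⟫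
      + ⟪P (z n - x n), (n : ℝ)⁻¹ • z n⟫ - ⟪q, (n : ℝ)⁻¹ • z n⟫
      + ⟪w n - y n, H ((n : ℝ)⁻¹ • z n)⟫ - β⁻¹ * ⟪w n - y n, (n : ℝ)⁻¹ • w n⟫
      + ⟪H (z n - x n), (n : ℝ)⁻¹ • w n⟫ - ⟪g, (n : ℝ)⁻¹ • w n⟫) atTop
      (𝓝 (-α⁻¹ * ⟪a, Z⟫ + ⟪P a, Z⟫ - ⟪q, Z⟫ + ⟪b, H Z⟫ - β⁻¹ * ⟪b, W⟫ + ⟪H a, W⟫ - ⟪g, W⟫)) :=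
    (((((((ha.inner hz').const_mul _).add (((P.continuous.tendsto _).comp ha).inner hz')).sub
      (tendsto_const_nhds.inner hz')).add (hb.inner ((H.continuous.tendsto _).comp hz'))).sub
      ((hb.inner hw').const_mul _)).add (((H.continuous.tendsto _).comp ha).inner hw')).sub
      (tendsto_const_nhds.inner hw')
  have h1 := le_of_tendsto_of_tendsto' (hp'.inner (tendsto_const_nhds (x := c))) hlim fun n => by
    have h2 : ⟪p n, c⟫ ≤ ⟪p n, z n⟫ := by
      have := hz n c hc
      rw [inner_sub_right] at this
      exact sub_nonpos.1 this
    have h3 := hmw n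
    have h4 := hP0 (z n)
    simp only [map_smul, real_inner_smul_left, real_inner_smul_right]
    have h5 : ⟪p n, c⟫ ≤ -α⁻¹ * ⟪z n - x n, z n⟫ + ⟪P (z n - x n), z n⟫ - ⟪q, z n⟫
        + ⟪w n - y n, H (z n)⟫ - β⁻¹ * ⟪w n - y n, w n⟫ + ⟪H (z n - x n), w n⟫ - ⟪g, w n⟫ := by
      refine h2.trans ?_
      simp only [p, m, inner_sub_left, inner_add_left, real_inner_smul_left, map_sub, map_smul,
        real_inner_comm (z n) (H' _), ← hadj, real_inner_comm (H (z n)) (w n),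
        real_inner_comm (H (z n)) (y n)] at h3 ⊢
      linarith
    have h6 := mul_le_mul_of_nonneg_left h5 (hpos n)
    linarith
  rw [hPs, hPZ, inner_zero_right, zero_add, hbHZ, hHaW, inner_neg_left, real_inner_comm c,
    ← hadj] at h1
  rw [inner_sub_left]
  linarith

end Iteration

section Euclidean
variable {ι κ : Type*} [Fintype ι] [Fintype κ] [DecidableEq κ]

/-- Variational characterization of the projection. -/
lemma proj_spec {C : Set (EuclideanSpace ℝ ι)} (hne : C.Nonempty) (hcl : IsClosed C)
    (hcv : Convex ℝ C) (x : EuclideanSpace ℝ ι) :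
    proj C x ∈ C ∧ ∀ c ∈ C, ⟪x - proj C x, c - proj C x⟫ ≤ 0 := by
  have hex : ∃ y ∈ C, ∀ c ∈ C, ‖x - y‖ ≤ ‖x - c‖ := by
    obtain ⟨y, hy, h⟩ := exists_norm_eq_iInf_of_complete_convex hne hcl.isComplete hcv x
    refine ⟨y, hy, fun c hc => h ▸ ciInf_le ⟨0, ?_⟩ (⟨c, hc⟩ : C)⟩
    rintro _ ⟨c, rfl⟩
    exact norm_nonneg _
  have hp : proj C x = hex.choose := dif_pos hex
  obtain ⟨h1, h2⟩ := hex.choose_spec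
  rw [← hp] at h1 h2
  refine ⟨h1, (norm_eq_iInf_iff_real_inner_le_zero hcv h1).1 (le_antisymm ?_ ?_)⟩
  · have : Nonempty C := ⟨⟨_, h1⟩⟩
    exact le_ciInf fun c => h2 c c.2
  · exact ciInf_le ⟨0, by rintro _ ⟨c, rfl⟩; exact norm_nonneg _⟩ (⟨_, h1⟩ : C)

/-- Variational inequality for a projected step of positive length. -/
lemma proj_step_spec {C : Set (EuclideanSpace ℝ ι)} (hne : C.Nonempty) (hcl : IsClosed C)
    (hcv : Convex ℝ C) {t : ℝ} (ht : 0 < t) {x d z : EuclideanSpace ℝ ι}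
    (hz : z = proj C (x + t • d)) :
    z ∈ C ∧ ∀ c ∈ C, ⟪t⁻¹ • (x - z) + d, c - z⟫ ≤ 0 := by
  have h := proj_spec hne hcl hcv (x + t • d)
  rw [← hz] at h
  refine ⟨h.1, fun c hc => ?_⟩
  have h1 : t⁻¹ • (x - z) + d = t⁻¹ • (x + t • d - z) := by
    rw [add_sub_right_comm, smul_add, inv_smul_smul₀ ht.ne']
  rw [h1, real_inner_smul_left]
  exact mul_nonpos_of_nonneg_of_nonpos (inv_pos.2 ht).le (h.2 c hc)

lemma isClosed_polarCone (K : Set (EuclideanSpace ℝ ι)) : IsClosed (polarCone K) := by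
  simp only [polarCone, Set.ofPred_forall]
  exact isClosed_iInter fun y => isClosed_iInter fun _ =>
    isClosed_le (by fun_prop) continuous_const

lemma zero_mem_polarCone (K : Set (EuclideanSpace ℝ ι)) : 0 ∈ polarCone K :=
  fun y _ => (inner_zero_left y).le

lemma add_mem_polarCone {K : Set (EuclideanSpace ℝ ι)} {u v : EuclideanSpace ℝ ι}
    (hu : u ∈ polarCone K) (hv : v ∈ polarCone K) : u + v ∈ polarCone K := fun y hy => by
  rw [inner_add_left]
  exact add_nonpos (hu y hy) (hv y hy)

lemma smul_mem_polarCone {K : Set (EuclideanSpace ℝ ι)} {u : EuclideanSpace ℝ ι}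
    (hu : u ∈ polarCone K) {r : ℝ} (hr : 0 ≤ r) : r • u ∈ polarCone K := fun y hy => by
  rw [real_inner_smul_left]
  exact mul_nonpos_of_nonneg_of_nonpos hr (hu y hy)

lemma convex_polarCone (K : Set (EuclideanSpace ℝ ι)) : Convex ℝ (polarCone K) :=
  fun _ hu _ hv _ _ ha hb _ => add_mem_polarCone (smul_mem_polarCone hu ha)
    (smul_mem_polarCone hv hb)

lemma inner_mvec [DecidableEq ι] (A : Matrix ι κ ℝ) (x : EuclideanSpace ℝ κ)
    (y : EuclideanSpace ℝ ι) : ⟪mvec A x, y⟫ = ⟪x, mvec Aᵀ y⟫ := by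
  rw [mvec, mvec, ← Matrix.conjTranspose_eq_transpose_of_trivial,
    Matrix.toEuclideanLin_conjTranspose_eq_adjoint, LinearMap.adjoint_inner_right]

lemma norm_mvec_le (A : Matrix ι κ ℝ) (x : EuclideanSpace ℝ κ) :
    ‖mvec A x‖ ≤ specNorm A * ‖x‖ :=
  (LinearMap.toContinuousLinearMap (Matrix.toEuclideanLin A)).le_opNorm x

lemma inner_mvec_self (P : Matrix κ κ ℝ) (x : EuclideanSpace ℝ κ) :
    ⟪mvec P x, x⟫ = star x.ofLp ⬝ᵥ (P *ᵥ x.ofLp) := by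
  simp [mvec, PiLp.inner_apply, dotProduct]

lemma inner_mvec_self_nonneg {P : Matrix κ κ ℝ} (hP : P.PosSemidef) (x : EuclideanSpace ℝ κ) :
    0 ≤ ⟪mvec P x, x⟫ := by
  rw [inner_mvec_self]
  exact hP.dotProduct_mulVec_nonneg _

lemma mvec_eq_zero_of_inner_self_nonpos {P : Matrix κ κ ℝ} (hP : P.PosSemidef)
    (x : EuclideanSpace ℝ κ) (hx : ⟪mvec P x, x⟫ ≤ 0) : mvec P x = 0 := by
  have h := hx.antisymm (inner_mvec_self_nonneg hP x)
  rw [inner_mvec_self, hP.dotProduct_mulVec_zero_iff] at h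
  exact congrArg (WithLp.toLp 2) h

end Euclidean

/-- a nonzero limit `w̄` is a proof of primal infeasibility:
`inf_{z∈D} ⟨Hz − g, w̄⟩ > sup_{y∈K} ⟨y, w̄⟩`. -/
theorem stmt10 {n m : ℕ} (P : Matrix (Fin n) (Fin n) ℝ) (q : EuclideanSpace ℝ (Fin n))
    (H : Matrix (Fin m) (Fin n) ℝ) (g : EuclideanSpace ℝ (Fin m))
    (D : Set (EuclideanSpace ℝ (Fin n))) (K : Set (EuclideanSpace ℝ (Fin m)))
    (hP : P.PosSemidef)
    (hDne : D.Nonempty) (hDcl : IsClosed D) (hDcv : Convex ℝ D)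
    (hKne : K.Nonempty) (hK : IsClosedConvexCone K)
    (α β ρ : ℝ) (hα : 0 < α) (hβ : 0 < β)
    (hstep : α * (specNorm P + β * specNorm H ^ 2) < 1)
    (hρ : ρ ∈ Set.Ioo (0 : ℝ) 2)
    (z ξ : ℕ → EuclideanSpace ℝ (Fin n)) (w η : ℕ → EuclideanSpace ℝ (Fin m))
    (hz : ∀ j, 1 ≤ j → z (j + 1) = proj D (ξ j - α • (mvec P (ξ j) + q + mvec Hᵀ (η j))))
    (hw : ∀ j, 1 ≤ j → w (j + 1) =
      proj (polarCone K) (η j + β • (mvec H ((2 : ℝ) • z (j + 1) - ξ j) - g)))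
    (hξ : ∀ j, 1 ≤ j → ξ (j + 1) = (1 - ρ) • ξ j + ρ • z (j + 1))
    (hη : ∀ j, 1 ≤ j → η (j + 1) = (1 - ρ) • η j + ρ • w (j + 1)) :
    ∀ wbar : EuclideanSpace ℝ (Fin m),
      Tendsto (fun j : ℕ => w (j + 1) - w j) atTop (𝓝 wbar) → wbar ≠ 0 →
      (⨆ y : K, ((⟪(y : EuclideanSpace ℝ (Fin m)), wbar⟫ : ℝ) : EReal)) <
        ⨅ zD : D, ((⟪mvec H (zD : EuclideanSpace ℝ (Fin n)) - g, wbar⟫ : ℝ) : EReal) := by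
  intro wbar hwbar hne
  let P' := LinearMap.toContinuousLinearMap (Matrix.toEuclideanLin P)
  let H₁ := LinearMap.toContinuousLinearMap (Matrix.toEuclideanLin H)
  let H₂ := LinearMap.toContinuousLinearMap (Matrix.toEuclideanLin Hᵀ)
  have hPs : ∀ x y, ⟪P' x, y⟫ = ⟪x, P' y⟫ := fun x y => by
    have h := inner_mvec P x y
    rwa [← Matrix.conjTranspose_eq_transpose_of_trivial, hP.isHermitian.eq] at h
  have hadj : ∀ x y, ⟪H₁ x, y⟫ = ⟪x, H₂ y⟫ := inner_mvec H
  have hP0 : ∀ x, 0 ≤ ⟪P' x, x⟫ := inner_mvec_self_nonneg hP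
  have hPz : ∀ x, ⟪P' x, x⟫ ≤ 0 → P' x = 0 := mvec_eq_zero_of_inner_self_nonpos hP
  have hzs : ∀ n, z (n + 2) ∈ D ∧ ∀ c ∈ D, ⟪α⁻¹ • (ξ (n + 1) - z (n + 2)) -
      (P' (ξ (n + 1)) + q + H₂ (η (n + 1))), c - z (n + 2)⟫ ≤ 0 := fun n => by
    simp only [sub_eq_add_neg (α⁻¹ • _)]
    refine proj_step_spec hDne hDcl hDcv hα ?_
    rw [smul_neg, ← sub_eq_add_neg]
    exact hz (n + 1) (Nat.le_add_left 1 n)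
  have hws : ∀ n, w (n + 2) ∈ polarCone K ∧ ∀ c ∈ polarCone K,
      ⟪β⁻¹ • (η (n + 1) - w (n + 2)) + (H₁ ((2 : ℝ) • z (n + 2) - ξ (n + 1)) - g),
        c - w (n + 2)⟫ ≤ 0 := fun n =>
    proj_step_spec ⟨0, zero_mem_polarCone K⟩ (isClosed_polarCone K) (convex_polarCone K) hβ
      (hw (n + 1) (Nat.le_add_left 1 n))
  have hξ' : ∀ n, ξ (n + 2) = ξ (n + 1) + ρ • (z (n + 2) - ξ (n + 1)) := fun n => by
    rw [hξ (n + 1) (Nat.le_add_left 1 n)]; module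
  have hη' : ∀ n, η (n + 2) = η (n + 1) + ρ • (w (n + 2) - η (n + 1)) := fun n => by
    rw [hη (n + 1) (Nat.le_add_left 1 n)]; module
  obtain ⟨v, hv⟩ := exists_tendsto_increment_of_bilin
    (stepForm P'.toLinearMap H₁.toLinearMap α β)
    (stepForm_comm hPs _ _ _)
    (stepForm_pos hα hβ hstep (norm_mvec_le P) (norm_mvec_le H)) hρ.1 hρ.2
    (s := fun n => (ξ (n + 1), η (n + 1)))
    (e := fun n => (z (n + 2) - ξ (n + 1), w (n + 2) - η (n + 1)))
    (fun n => Prod.ext (hξ' n) (hη' n))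
    (stepForm_monotone (H' := H₂.toLinearMap) hadj hP0 (x := fun n => ξ (n + 1))
      (z := fun n => z (n + 2)) (y := fun n => η (n + 1)) (w := fun n => w (n + 2))
      (fun n => (hzs n).1) (fun n => (hws n).1) (fun n => (hzs n).2) (fun n => (hws n).2))
  have ha : Tendsto (fun n => z (n + 2) - ξ (n + 1)) atTop (𝓝 v.1) := hv _ (LinearMap.fst ℝ _ _)
  have hb : Tendsto (fun n => w (n + 2) - η (n + 1)) atTop (𝓝 v.2) := hv _ (LinearMap.snd ℝ _ _)
  obtain ⟨hWC, hsep⟩ := le_inner_of_tendsto_residual hadj hPs hP0 hPz hρ.1 hDne hDcl hDcv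
    (isClosed_polarCone K) (zero_mem_polarCone K) (fun _ hu _ hv => add_mem_polarCone hu hv)
    (fun _ hu _ hr => smul_mem_polarCone hu hr) (x := fun n => ξ (n + 1))
    (z := fun n => z (n + 2)) (y := fun n => η (n + 1)) (w := fun n => w (n + 2))
    (fun n => (hzs n).1) (fun n => (hws n).1) (fun n => (hzs n).2) (fun n => (hws n).2)
    hξ' hη' ha hb
  have hwb : wbar = ρ • v.2 := by
    have h1 : Tendsto (fun n => w (n + 3) - w (n + 2)) atTop (𝓝 (v.2 + (ρ - 1) • v.2)) := by
      refine ((hb.comp (tendsto_add_atTop_nat 1)).add (hb.const_smul (ρ - 1))).congr fun n => ?_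
      simp only [Function.comp_apply, add_assoc, Nat.reduceAdd]
      rw [hη' n]
      module
    rw [tendsto_nhds_unique (hwbar.comp (tendsto_add_atTop_nat 2)) h1]
    module
  rw [← hwb] at hWC hsep
  have hv2 : v.2 ≠ 0 := fun h => hne (by rw [hwb, h, smul_zero])
  have hpos : 0 < β⁻¹ * ⟪v.2, wbar⟫ := by
    rw [hwb, real_inner_smul_right, real_inner_self_eq_norm_sq]
    have := norm_pos_iff.2 hv2
    have := hρ.1
    positivity
  have hsup : (⨆ y : K, ((⟪(y : EuclideanSpace ℝ (Fin m)), wbar⟫ : ℝ) : EReal)) ≤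
      ((0 : ℝ) : EReal) :=
    iSup_le fun y => EReal.coe_le_coe_iff.2 (by rw [real_inner_comm]; exact hWC y y.2)
  refine (hsup.trans_lt (EReal.coe_lt_coe_iff.2 hpos)).trans_le (le_iInf fun c => ?_)
  exact EReal.coe_le_coe_iff.2 (hsep c c.2)
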